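/- Let n' = n+1 for input strings of length n, and let E_{r,s,n'} = {i/(2^s n') | −2^{r+s}n' ≤ i < 2^{r+s}n'} be the extra-precision numbers, with fixed(a) = ⌊a·2^s⌋·2^{−s} and extra(a) = ⌊a·2^s·n'⌋ − ⌊a·2^s⌋·n'. Say a : Σ* → E_{r,s,n'} is defined by ⟨σ^a_k, φ^a_extra[x]⟩ in FOC[+;MOD] if the sentences σ^a_k (k ∈ [−s,r]) define fixed(a(w)) bitwise (w ⊨ σ^a_k iff bit k of the two's-complement representation of fixed(a(w)) is 1) and w ⊨ φ^a_extra[x] iff x = extra(a(w)). If a and b are functions Σ* → E_{r,s,n'} defined by such families of formulas, and (a+b)(w) ∈ E_{r,s,n'} for all w, then a+b is defined by some family ⟨σ^{a+b}_k, φ^{a+b}_extra[x]⟩; similarly a−b is definable when (a−b)(w) ∈ E_{r,s,n'} for all w. -/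

import Mathlib

namespace FOC

/-- Count terms: affine combinations `c₀ + c₁·x₁ + ⋯ + cₖ·xₖ` with rational
coefficients over count variables (named by naturals). -/
structure CTerm where
  const : ℚ
  coeffs : List (ℚ × ℕ)

/-- Evaluate a count term under a count-variable assignment. -/
def CTerm.eval (t : CTerm) (ν : ℕ → ℚ) : ℚ :=
  t.const + (t.coeffs.map fun c => c.1 * ν c.2).sum

/-- The count variables occurring in a count term. -/
def CTerm.vars (t : CTerm) : Finset ℕ :=
  (t.coeffs.map Prod.snd).toFinset

/-- The count term consisting of a single variable. -/
def CTerm.var (x : ℕ) : CTerm := ⟨0, [(1, x)]⟩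

/-- A constant count term. -/
def CTerm.cst (c : ℚ) : CTerm := ⟨c, []⟩

/-- Formulas of FOC[+;MOD] over the alphabet `A`.  Position variables and
count variables are both named by naturals (the two sorts are separate). -/
inductive Formula (A : Type) : Type
  | tru : Formula A
  | fls : Formula A
  | qa (a : A) (p : ℕ) : Formula A
  | mod (r m : ℕ) (p : ℕ) : Formula A
  | eq (t₁ t₂ : CTerm) : Formula A
  | lt (t₁ t₂ : CTerm) : Formula A
  | and (φ ψ : Formula A) : Formula A
  | or (φ ψ : Formula A) : Formula A
  | not (φ : Formula A) : Formula A
  | exC (x : ℕ) (φ : Formula A) : Formula A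
  | allC (x : ℕ) (φ : Formula A) : Formula A
  | cnt (x : ℕ) (p : ℕ) (φ : Formula A) : Formula A

variable {A : Type}

open Classical in
/-- Satisfaction of a formula in a string `w` (positions are `1,…,w.length`;
the letter at position `p` is `w[p-1]`), under a position assignment `ρ` and a
count assignment `ν`.  The counting quantifier `cnt x p φ` holds iff the number
of positions `j ∈ [1, w.length]` satisfying `φ` equals `ν x`. -/
def Sat (w : List A) : (ℕ → ℕ) → (ℕ → ℚ) → Formula A → Prop
  | _, _, .tru => True
  | _, _, .fls => False
  | ρ, _, .qa a p => w[ρ p - 1]? = some a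
  | ρ, _, .mod r m p => ρ p % m = r % m
  | _, ν, .eq t₁ t₂ => t₁.eval ν = t₂.eval ν
  | _, ν, .lt t₁ t₂ => t₁.eval ν < t₂.eval ν
  | ρ, ν, .and φ ψ => Sat w ρ ν φ ∧ Sat w ρ ν ψ
  | ρ, ν, .or φ ψ => Sat w ρ ν φ ∨ Sat w ρ ν ψ
  | ρ, ν, .not φ => ¬ Sat w ρ ν φ
  | ρ, ν, .exC x φ => ∃ q : ℚ, Sat w ρ (Function.update ν x q) φ
  | ρ, ν, .allC x φ => ∀ q : ℚ, Sat w ρ (Function.update ν x q) φ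
  | ρ, ν, .cnt x p φ =>
      (((Finset.Icc 1 w.length).filter
          (fun j => Sat w (Function.update ρ p j) ν φ)).card : ℚ) = ν x

/-- Free position variables of a formula. -/
def freePos : Formula A → Finset ℕ
  | .tru => ∅
  | .fls => ∅
  | .qa _ p => {p}
  | .mod _ _ p => {p}
  | .eq _ _ => ∅
  | .lt _ _ => ∅
  | .and φ ψ => freePos φ ∪ freePos ψ
  | .or φ ψ => freePos φ ∪ freePos ψ
  | .not φ => freePos φ
  | .exC _ φ => freePos φ
  | .allC _ φ => freePos φ
  | .cnt _ p φ => freePos φ \ {p}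

/-- Free count variables of a formula. -/
def freeCount : Formula A → Finset ℕ
  | .tru => ∅
  | .fls => ∅
  | .qa _ _ => ∅
  | .mod _ _ _ => ∅
  | .eq t₁ t₂ => t₁.vars ∪ t₂.vars
  | .lt t₁ t₂ => t₁.vars ∪ t₂.vars
  | .and φ ψ => freeCount φ ∪ freeCount ψ
  | .or φ ψ => freeCount φ ∪ freeCount ψ
  | .not φ => freeCount φ
  | .exC x φ => freeCount φ \ {x}
  | .allC x φ => freeCount φ \ {x}
  | .cnt x _ φ => freeCount φ ∪ {x}

/-- Quantifier-free formulas (no `∃x`, `∀x`, and no counting quantifier). -/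
def QFree : Formula A → Prop
  | .and φ ψ => QFree φ ∧ QFree ψ
  | .or φ ψ => QFree φ ∧ QFree ψ
  | .not φ => QFree φ
  | .exC _ _ => False
  | .allC _ _ => False
  | .cnt _ _ _ => False
  | _ => True

/-- Two formulas are equivalent if they have the same truth value in every
string under every assignment of the (position and count) variables. -/
def FOCEquiv (φ ψ : Formula A) : Prop :=
  ∀ (w : List A) (ρ : ℕ → ℕ) (ν : ℕ → ℚ), Sat w ρ ν φ ↔ Sat w ρ ν ψ

/-- A sentence is a formula without free variables. -/
def IsSentence (φ : Formula A) : Prop := freePos φ = ∅ ∧ freeCount φ = ∅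

/-- The language defined by a sentence. -/
def Defines (σ : Formula A) (L : Set (List A)) : Prop :=
  ∀ w, w ∈ L ↔ Sat w (fun _ => 1) (fun _ => 0) σ

/-- Finite conjunction. -/
def bigAnd (l : List (Formula A)) : Formula A := l.foldr .and .tru

/-- Finite disjunction. -/
def bigOr (l : List (Formula A)) : Formula A := l.foldr .or .fls

/-- Iterated existential count quantification `∃x₁.…∃xₖ. φ`. -/
def exCs (xs : List ℕ) (φ : Formula A) : Formula A := xs.foldr .exC φ

end FOC

namespace FOC

/-- Fixed-precision numbers `F_{r,s} = {i/2^s | −2^{r+s} ≤ i < 2^{r+s}}`, as rationals. -/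
def FsetQ (r s : ℕ) : Set ℚ :=
  {q | ∃ i : ℤ, -(2:ℤ)^(r+s) ≤ i ∧ i < 2^(r+s) ∧ q = (i : ℚ) / 2^s}

/-- Extra-precision numbers `E_{r,s,n'} = {i/(2^s n') | −2^{r+s}n' ≤ i < 2^{r+s}n'}`. -/
def EsetQ (r s n' : ℕ) : Set ℚ :=
  {q | ∃ i : ℤ, -((2:ℤ)^(r+s) * n') ≤ i ∧ i < 2^(r+s) * n' ∧ q = (i : ℚ) / (2^s * n')}

/-- The `k`-th bit of the two's-complement representation:
`bit_k(x) = ⌊x/2^k⌋ − 2⌊x/2^{k+1}⌋`. -/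
def bit (k : ℤ) (x : ℚ) : ℤ := ⌊x / (2:ℚ)^k⌋ - 2 * ⌊x / (2:ℚ)^(k+1)⌋

/-- `fixed(a) = ⌊a·2^s⌋·2^{−s}`: the fixed-precision part of an extra-precision number. -/
def fixedPart (s : ℕ) (a : ℚ) : ℚ := (⌊a * 2^s⌋ : ℚ) / 2^s

/-- `extra(a) = ⌊a·2^s·n'⌋ − ⌊a·2^s⌋·n'`: the extra digit of an extra-precision number. -/
def extraDigit (s n' : ℕ) (a : ℚ) : ℤ := ⌊a * 2^s * n'⌋ - ⌊a * 2^s⌋ * n'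

/-- `a : Σ* → F_{r,s}` is defined by the family of sentences `σ k` (for
`k ∈ [−s, r]`) if `w ⊨ σ k` iff bit `k` of `a(w)` is 1. -/
def DefinedBy {A : Type} (r s : ℕ) (a : List A → ℚ) (σ : ℤ → Formula A) : Prop :=
  ∀ k : ℤ, -(s:ℤ) ≤ k → k ≤ r →
    IsSentence (σ k) ∧
    ∀ w, (Sat w (fun _ => 1) (fun _ => 0) (σ k) ↔ bit k (a w) = 1)

/-- `a : Σ* → E_{r,s,n'}` (with `n' = |w|+1`) is defined by `⟨σ k, φx⟩` if the
sentences `σ k` define `fixed(a(w))` bitwise and `φx`, whose only free variable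
is the count variable `xv`, holds of `q` iff `q = extra(a(w))`. -/
def EDefinedBy {A : Type} (r s : ℕ) (a : List A → ℚ) (σ : ℤ → Formula A)
    (xv : ℕ) (φx : Formula A) : Prop :=
  DefinedBy r s (fun w => fixedPart s (a w)) σ ∧
  freePos φx = ∅ ∧ freeCount φx ⊆ {xv} ∧
  ∀ (w : List A) (q : ℚ),
    (Sat w (fun _ => 1) (Function.update (fun _ => 0) xv q) φx ↔
      q = (extraDigit s (w.length + 1) (a w) : ℚ))

end FOC

namespace FOC

/-- Satisfaction depends only on the values of the free variables. -/
theorem sat_congr {A : Type} (w : List A) (φ : Formula A) :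
    ∀ {ρ ρ' : ℕ → ℕ} {ν ν' : ℕ → ℚ}, (∀ p ∈ freePos φ, ρ p = ρ' p) →
      (∀ x ∈ freeCount φ, ν x = ν' x) → (Sat w ρ ν φ ↔ Sat w ρ' ν' φ) := by
  have eval_congr : ∀ (t : CTerm) (ν ν' : ℕ → ℚ), (∀ x ∈ t.vars, ν x = ν' x) →
      t.eval ν = t.eval ν' := by
    intro t ν ν' h
    unfold CTerm.eval
    congr 2
    refine List.map_congr_left fun c hc => ?_
    rw [h c.2 (by simpa [CTerm.vars] using ⟨c.1, hc⟩)]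
  have update_congr : ∀ {β : Type} (f g : ℕ → β) (S : Finset ℕ) (x : ℕ) (b : β),
      (∀ y ∈ S \ {x}, f y = g y) →
      ∀ y ∈ S, Function.update f x b y = Function.update g x b y := by
    intro β f g S x b h y hy
    by_cases hyx : y = x
    · subst hyx; simp
    · simpa [Function.update_of_ne hyx] using h y (by simp [hy, hyx])
  induction φ with
  | tru => intros; simp [Sat]
  | fls => intros; simp [Sat]
  | qa a p => intro ρ ρ' ν ν' hp hc; simp [Sat, hp p (by simp [freePos])]
  | mod r m p => intro ρ ρ' ν ν' hp hc; simp [Sat, hp p (by simp [freePos])]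
  | eq t₁ t₂ =>
    intro ρ ρ' ν ν' hp hc
    simp only [freeCount, Finset.mem_union] at hc
    simp only [Sat]
    rw [eval_congr t₁ ν ν' fun x hx => hc x (.inl hx),
      eval_congr t₂ ν ν' fun x hx => hc x (.inr hx)]
  | lt t₁ t₂ =>
    intro ρ ρ' ν ν' hp hc
    simp only [freeCount, Finset.mem_union] at hc
    simp only [Sat]
    rw [eval_congr t₁ ν ν' fun x hx => hc x (.inl hx),
      eval_congr t₂ ν ν' fun x hx => hc x (.inr hx)]
  | and φ ψ ihφ ihψ =>
    intro ρ ρ' ν ν' hp hc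
    simp only [freeCount, freePos, Finset.mem_union] at hp hc
    exact and_congr (ihφ (fun p h => hp p (.inl h)) fun x h => hc x (.inl h))
      (ihψ (fun p h => hp p (.inr h)) fun x h => hc x (.inr h))
  | or φ ψ ihφ ihψ =>
    intro ρ ρ' ν ν' hp hc
    simp only [freeCount, freePos, Finset.mem_union] at hp hc
    exact or_congr (ihφ (fun p h => hp p (.inl h)) fun x h => hc x (.inl h))
      (ihψ (fun p h => hp p (.inr h)) fun x h => hc x (.inr h))
  | not φ ih => intro ρ ρ' ν ν' hp hc; exact not_congr (ih hp hc)
  | exC x φ ih =>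
    intro ρ ρ' ν ν' hp hc
    exact exists_congr fun q => ih hp (update_congr ν ν' _ x q hc)
  | allC x φ ih =>
    intro ρ ρ' ν ν' hp hc
    exact forall_congr' fun q => ih hp (update_congr ν ν' _ x q hc)
  | cnt x p φ ih =>
    intro ρ ρ' ν ν' hp hc
    simp only [freeCount, Finset.mem_union] at hc
    have key : ∀ j, Sat w (Function.update ρ p j) ν φ ↔ Sat w (Function.update ρ' p j) ν' φ :=
      fun j => ih (update_congr ρ ρ' _ p j hp) fun y hy => hc y (.inl hy)
    simp only [Sat]
    refine iff_of_eq (congrArg₂ _ (congrArg _ (congrArg _ ?_)) (hc x (.inr (by simp))))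
    classical exact Finset.filter_congr fun j _ => key j

/-- A property of strings is definable if some sentence expresses it. -/
def Definable {A : Type} (P : List A → Prop) : Prop :=
  ∃ σ : Formula A, IsSentence σ ∧ ∀ w, Sat w (fun _ => 1) (fun _ => 0) σ ↔ P w

namespace Definable

variable {A : Type} {P Q : List A → Prop}

theorem and (hP : Definable P) (hQ : Definable Q) : Definable fun w => P w ∧ Q w := by
  obtain ⟨σ, hσ, h⟩ := hP
  obtain ⟨τ, hτ, h'⟩ := hQ
  exact ⟨.and σ τ, by simp_all [IsSentence, freePos, freeCount], fun w => and_congr (h w) (h' w)⟩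

theorem or (hP : Definable P) (hQ : Definable Q) : Definable fun w => P w ∨ Q w := by
  obtain ⟨σ, hσ, h⟩ := hP
  obtain ⟨τ, hτ, h'⟩ := hQ
  exact ⟨.or σ τ, by simp_all [IsSentence, freePos, freeCount], fun w => or_congr (h w) (h' w)⟩

theorem not (hP : Definable P) : Definable fun w => ¬ P w := by
  obtain ⟨σ, hσ, h⟩ := hP
  exact ⟨.not σ, hσ, fun w => not_congr (h w)⟩

theorem const (p : Prop) : Definable fun _ : List A => p := by
  by_cases hp : p
  · exact ⟨.tru, by simp [IsSentence, freePos, freeCount], by simp [Sat, hp]⟩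
  · exact ⟨.fls, by simp [IsSentence, freePos, freeCount], by simp [Sat, hp]⟩

theorem iff_const (hP : Definable P) (p : Prop) : Definable fun w => P w ↔ p := by
  by_cases hp : p
  · simpa [hp] using hP
  · simpa [hp] using hP.not

theorem exists_mem {ι : Type*} (S : Finset ι) {R : ι → List A → Prop}
    (h : ∀ i ∈ S, Definable (R i)) : Definable fun w => ∃ i ∈ S, R i w := by
  classical
  induction S using Finset.induction_on with
  | empty => simpa using const False
  | insert i S hi ih =>
    simpa using (h i (by simp)).or (ih fun j hj => h j (by simp [hj]))

theorem forall_mem {ι : Type*} (S : Finset ι) {R : ι → List A → Prop}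
    (h : ∀ i ∈ S, Definable (R i)) : Definable fun w => ∀ i ∈ S, R i w := by
  simpa using (exists_mem S fun i hi => (h i hi).not).not

end Definable

/-- `ψ` defines the value of `e` in the count variable `x`. -/
def DefinesValue {A : Type} (e : List A → ℚ) (x : ℕ) (ψ : Formula A) : Prop :=
  freePos ψ = ∅ ∧ freeCount ψ ⊆ {x} ∧
    ∀ (w : List A) (ρ : ℕ → ℕ) (ν : ℕ → ℚ), Sat w ρ ν ψ ↔ ν x = e w

/-- The string length is definable in any count variable. -/
theorem definesValue_length {A : Type} (x : ℕ) :
    DefinesValue (fun w : List A => (w.length : ℚ)) x (.cnt x 0 .tru) :=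
  ⟨by simp [freePos], by simp [freeCount], fun w ρ ν => by
    classical
    change (((Finset.Icc 1 w.length).filter
      fun j => Sat w (Function.update ρ 0 j) ν .tru).card : ℚ) = ν x ↔ _
    rw [Finset.filter_true_of_mem fun _ _ => by simp [Sat]]
    simp [eq_comm]⟩

/-- A value definable in one count variable is definable in every count variable. -/
theorem exists_definesValue {A : Type} {e : List A → ℚ} {y : ℕ} {φ : Formula A}
    (hp : freePos φ = ∅) (hc : freeCount φ ⊆ {y})
    (h : ∀ (w : List A) (q : ℚ),
      Sat w (fun _ => 1) (Function.update (fun _ => 0) y q) φ ↔ q = e w) (x : ℕ) :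
    ∃ ψ, DefinesValue e x ψ := by
  have key : ∀ (w : List A) (ρ : ℕ → ℕ) (ν : ℕ → ℚ), Sat w ρ ν φ ↔ ν y = e w := by
    intro w ρ ν
    rw [← h w (ν y)]
    refine sat_congr w φ (by simp [hp]) fun z hz => ?_
    obtain rfl : z = y := by simpa using hc hz
    simp
  by_cases hxy : x = y
  · subst hxy
    exact ⟨φ, hp, hc, key⟩
  · refine ⟨.exC y (.and (.eq (.var y) (.var x)) φ), by simp [freePos, hp], ?_, fun w ρ ν => ?_⟩
    · intro z hz
      simp only [freeCount, CTerm.vars, CTerm.var, Finset.mem_sdiff, Finset.mem_union,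
        List.map_cons, List.map_nil, List.toFinset_cons, List.toFinset_nil] at hz
      have := @hc z
      simp at hz this ⊢
      tauto
    · simp [Sat, key, CTerm.eval, CTerm.var, Function.update_of_ne hxy, eq_comm]

/-- Quantifying three definable values out of a formula. -/
theorem exists_formula_of_values {A : Type} {e₀ e₁ e₂ : List A → ℚ} {ψ₀ ψ₁ ψ₂ : Formula A}
    (h₀ : DefinesValue e₀ 0 ψ₀) (h₁ : DefinesValue e₁ 1 ψ₁) (h₂ : DefinesValue e₂ 2 ψ₂)
    (χ : Formula A) (hχ : freePos χ = ∅) :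
    ∃ Ψ : Formula A, freePos Ψ = ∅ ∧ freeCount Ψ ⊆ freeCount χ \ {0, 1, 2} ∧
      ∀ w ρ ν, Sat w ρ ν Ψ ↔ Sat w ρ (Function.update (Function.update (Function.update ν
        0 (e₀ w)) 1 (e₁ w)) 2 (e₂ w)) χ := by
  obtain ⟨p₀, c₀, s₀⟩ := h₀
  obtain ⟨p₁, c₁, s₁⟩ := h₁
  obtain ⟨p₂, c₂, s₂⟩ := h₂
  refine ⟨.exC 0 (.exC 1 (.exC 2 (.and ψ₀ (.and ψ₁ (.and ψ₂ χ))))),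
    by simp [freePos, *], ?_, fun w ρ ν => ?_⟩
  · intro z hz
    have a₀ := @c₀ z
    have a₁ := @c₁ z
    have a₂ := @c₂ z
    simp [freeCount] at hz a₀ a₁ a₂ ⊢
    tauto
  · simp [Sat, s₀, s₁, s₂]

/-- A two's-complement integer is determined by its bits. -/
theorem int_eq_of_bits (m : ℕ) : ∀ i j : ℤ, -2 ^ m ≤ i → i < 2 ^ m → -2 ^ m ≤ j → j < 2 ^ m →
    (∀ k ≤ m, i / 2 ^ k % 2 = j / 2 ^ k % 2) → i = j := by
  induction m with
  | zero =>
    intro i j h1 h2 h3 h4 h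
    have := h 0 le_rfl
    norm_num at *
    omega
  | succ m ih =>
    intro i j h1 h2 h3 h4 h
    have h0 := h 0 (by omega)
    have := ih (i / 2) (j / 2) (by rw [pow_succ] at *; omega) (by rw [pow_succ] at *; omega)
      (by rw [pow_succ] at *; omega) (by rw [pow_succ] at *; omega) fun k hk => by
        have := h (k + 1) (by omega)
        rwa [pow_succ', ← Int.ediv_ediv_of_nonneg (by norm_num),
          ← Int.ediv_ediv_of_nonneg (by norm_num)] at this
    norm_num at h0
    omega

theorem bit_int_div (s k : ℕ) (i : ℤ) :
    bit ((k : ℤ) - s) ((i : ℚ) / 2 ^ s) = i / 2 ^ k % 2 := by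
  have key : ∀ k : ℕ, ⌊(i : ℚ) / 2 ^ s / (2 : ℚ) ^ ((k : ℤ) - s)⌋ = i / 2 ^ k := by
    intro k
    have : (i : ℚ) / 2 ^ s / (2 : ℚ) ^ ((k : ℤ) - s) = (i : ℚ) / ((2 ^ k : ℕ) : ℚ) := by
      rw [zpow_sub₀ (by norm_num)]
      push_cast
      simp only [zpow_natCast]
      field_simp
    rw [this, Rat.floor_intCast_div_natCast]
    push_cast
    rfl
  unfold bit
  have e : ((k : ℤ) - s + 1) = ((k + 1 : ℕ) : ℤ) - s := by push_cast; ring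
  rw [e, key, key, pow_succ, ← Int.ediv_ediv_of_nonneg (by positivity)]
  omega

theorem floor_and_extraDigit (s n' : ℕ) (hn : 0 < n') (i : ℤ) (x : ℚ)
    (hx : x = i / (2 ^ s * n')) : ⌊x * 2 ^ s⌋ = i / n' ∧ extraDigit s n' x = i % n' := by
  have h0 : (n' : ℚ) ≠ 0 := by positivity
  have h1 : x * 2 ^ s = (i : ℚ) / n' := by rw [hx]; field_simp
  have h2 : ⌊x * 2 ^ s⌋ = i / n' := by rw [h1, Rat.floor_intCast_div_natCast]
  refine ⟨h2, ?_⟩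
  rw [extraDigit, h2, h1, div_mul_cancel₀ _ h0, Int.floor_intCast, Int.emod_def]
  ring

theorem floor_mem_Ico {r s n' : ℕ} (hn : 0 < n') {x : ℚ} (hx : x ∈ EsetQ r s n') :
    ⌊x * 2 ^ s⌋ ∈ Finset.Ico (-(2 : ℤ) ^ (r + s)) (2 ^ (r + s)) := by
  obtain ⟨i, h1, h2, h3⟩ := hx
  have hn' : (0 : ℤ) < n' := by exact_mod_cast hn
  rw [(floor_and_extraDigit s n' hn i x h3).1, Finset.mem_Ico]
  exact ⟨(Int.le_ediv_iff_mul_le hn').2 (by linarith), (Int.ediv_lt_iff_lt_mul hn').2 h2⟩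

/-- The fixed part of a definable function takes any given value definably. -/
theorem definable_floor_eq {A : Type} {r s : ℕ} {a : List A → ℚ} {σ : ℤ → Formula A}
    (ha : ∀ w, a w ∈ EsetQ r s (w.length + 1))
    (h : DefinedBy r s (fun w => fixedPart s (a w)) σ) (u : ℤ)
    (hu : u ∈ Finset.Ico (-(2 : ℤ) ^ (r + s)) (2 ^ (r + s))) :
    Definable fun w => ⌊a w * 2 ^ s⌋ = u := by
  have hd : Definable fun w => ∀ k ∈ Finset.range (r + s + 1),
      (bit ((k : ℤ) - s) (fixedPart s (a w)) = 1 ↔ bit ((k : ℤ) - s) ((u : ℚ) / 2 ^ s) = 1) := by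
    refine Definable.forall_mem _ fun k hk => Definable.iff_const ?_ _
    rw [Finset.mem_range] at hk
    exact ⟨σ _, h _ (by omega) (by omega)⟩
  convert hd using 2 with w
  refine ⟨fun e k _ => by simp [fixedPart, e], fun e => ?_⟩
  have hw := floor_mem_Ico (Nat.succ_pos _) (ha w)
  rw [Finset.mem_Ico] at hw hu
  refine int_eq_of_bits (r + s) _ _ hw.1 hw.2 hu.1 hu.2 fun k hk => ?_
  have := e k (by simp; omega)
  rw [fixedPart, bit_int_div, bit_int_div] at this
  omega

/-- States that `⌊(x₀ + ε·x₁) / (x₂ + 1)⌋ = c`: the extra digits `x₀` and `x₁` carry `c` over to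
the fixed part when `x₂` is the string length. -/
def carryFormula {A : Type} (ε c : ℤ) : Formula A :=
  .and (.not (.lt ⟨0, [(1, 0), (ε, 1)]⟩ ⟨c, [(c, 2)]⟩))
    (.lt ⟨0, [(1, 0), (ε, 1)]⟩ ⟨c + 1, [(c + 1, 2)]⟩)

theorem sat_carryFormula {A : Type} (w : List A) (ρ : ℕ → ℕ) (ν : ℕ → ℚ) (ε c x y : ℤ)
    (h₀ : ν 0 = x) (h₁ : ν 1 = y) (h₂ : ν 2 = w.length) :
    Sat w ρ ν (carryFormula ε c) ↔ (x + ε * y) / ((w.length + 1 : ℕ) : ℤ) = c := by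
  rw [Int.ediv_eq_iff_of_pos (by positivity)]
  simp only [carryFormula, Sat, CTerm.eval, h₀, h₁, h₂, List.map_cons, List.map_nil,
    List.sum_cons, List.sum_nil, not_lt]
  rw [← @Int.cast_le ℚ, ← @Int.cast_lt ℚ]
  push_cast
  constructor <;> rintro ⟨h, h'⟩ <;> constructor <;> linarith

theorem exists_eDefinedBy_add_mul {A : Type} (r s : ℕ) (a b : List A → ℚ)
    (ha : ∀ w, a w ∈ EsetQ r s (w.length + 1)) (hb : ∀ w, b w ∈ EsetQ r s (w.length + 1))
    (σa : ℤ → Formula A) (xa : ℕ) (φa : Formula A) (hda : EDefinedBy r s a σa xa φa)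
    (σb : ℤ → Formula A) (xb : ℕ) (φb : Formula A) (hdb : EDefinedBy r s b σb xb φb)
    (ε : ℤ) (hε : ε = 1 ∨ ε = -1) :
    ∃ (σ : ℤ → Formula A) (xv : ℕ) (φx : Formula A),
      EDefinedBy r s (fun w => a w + ε * b w) σ xv φx := by
  obtain ⟨hσa, pa, ca, sa⟩ := hda
  obtain ⟨hσb, pb, cb, sb⟩ := hdb
  obtain ⟨ψa, hψa⟩ := exists_definesValue pa ca sa 0
  obtain ⟨ψb, hψb⟩ := exists_definesValue pb cb sb 1
  have hlen := definesValue_length (A := A) 2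
  let e (x : List A → ℚ) (w : List A) : ℤ := extraDigit s (w.length + 1) (x w)
  let carry (w : List A) : ℤ := (e a w + ε * e b w) / ((w.length + 1 : ℕ) : ℤ)
  have arith : ∀ w, ⌊(a w + ε * b w) * 2 ^ s⌋
        = ⌊a w * 2 ^ s⌋ + ε * ⌊b w * 2 ^ s⌋ + carry w ∧
      e (fun w => a w + ε * b w) w = e a w + ε * e b w - carry w * ((w.length + 1 : ℕ) : ℤ) ∧
      carry w ∈ Finset.Icc (-1 : ℤ) 1 := by
    intro w
    obtain ⟨i, -, -, hi⟩ := ha w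
    obtain ⟨j, -, -, hj⟩ := hb w
    have hn : 0 < w.length + 1 := Nat.succ_pos _
    have fa := floor_and_extraDigit s _ hn i _ hi
    have fb := floor_and_extraDigit s _ hn j _ hj
    have fc := floor_and_extraDigit s _ hn (i + ε * j) (a w + ε * b w)
      (by rw [hi, hj]; push_cast; ring)
    simp only [e, carry]
    rw [fa.1, fa.2, fb.1, fb.2, fc.1, fc.2]
    generalize hN : ((w.length + 1 : ℕ) : ℤ) = N
    have hN0 : 0 < N := by omega
    have key : (i + ε * j) / N = i / N + ε * (j / N) + (i % N + ε * (j % N)) / N := by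
      have : i + ε * j = (i % N + ε * (j % N)) + (i / N + ε * (j / N)) * N := by
        linear_combination -(Int.emod_add_mul_ediv i N) - ε * (Int.emod_add_mul_ediv j N)
      conv_lhs => rw [this]
      rw [Int.add_mul_ediv_right _ _ hN0.ne']
      ring
    refine ⟨key, ?_, ?_⟩
    · rw [Int.emod_def (i + ε * j), key, Int.emod_def i, Int.emod_def j]
      ring
    · have := Int.emod_nonneg i hN0.ne'
      have := Int.emod_nonneg j hN0.ne'
      have := Int.emod_lt_of_pos i hN0
      have := Int.emod_lt_of_pos j hN0
      rw [Finset.mem_Icc]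
      constructor
      · rw [Int.le_ediv_iff_mul_le hN0]
        rcases hε with rfl | rfl <;> linarith
      · rw [← Int.lt_add_one_iff, Int.ediv_lt_iff_lt_mul hN0]
        rcases hε with rfl | rfl <;> linarith
  have hcarry : ∀ c, Definable fun w => carry w = c := by
    intro c
    obtain ⟨Ψ, hp, hc, hs⟩ := exists_formula_of_values hψa hψb hlen
      (carryFormula ε c) (by simp [carryFormula, freePos])
    refine ⟨Ψ, ⟨hp, ?_⟩, fun w => ?_⟩
    · rw [← Finset.subset_empty]
      intro z hz
      have := hc hz
      simp [carryFormula, freeCount, CTerm.vars] at this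
    · rw [hs]
      exact sat_carryFormula w _ _ ε c (e a w) (e b w) (by simp [e])
        (by simp [e]) (by simp)
  have hbits : ∀ k, Definable fun w => bit k (fixedPart s (a w + ε * b w)) = 1 := by
    intro k
    have hd : Definable fun w =>
        ∃ u ∈ Finset.Ico (-(2 : ℤ) ^ (r + s)) (2 ^ (r + s)),
        ∃ v ∈ Finset.Ico (-(2 : ℤ) ^ (r + s)) (2 ^ (r + s)), ∃ c ∈ Finset.Icc (-1 : ℤ) 1,
        ⌊a w * 2 ^ s⌋ = u ∧ ⌊b w * 2 ^ s⌋ = v ∧ carry w = c ∧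
          bit k (((u + ε * v + c : ℤ) : ℚ) / 2 ^ s) = 1 :=
      .exists_mem _ fun u hu => .exists_mem _ fun v hv => .exists_mem _ fun c _ =>
        (definable_floor_eq ha hσa u hu).and ((definable_floor_eq hb hσb v hv).and
          ((hcarry c).and (.const _)))
    convert hd using 2 with w
    rw [fixedPart, (arith w).1]
    constructor
    · intro h
      exact ⟨_, floor_mem_Ico (Nat.succ_pos _) (ha w), _, floor_mem_Ico (Nat.succ_pos _) (hb w),
        _, (arith w).2.2, rfl, rfl, rfl, h⟩
    · rintro ⟨_, -, _, -, _, -, rfl, rfl, rfl, h⟩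
      exact h
  choose σ hσ using hbits
  let χ (c : ℤ) : Formula A := .and (carryFormula ε c)
    (.eq (.var 3) ⟨-c, [(1, 0), (ε, 1), (-c, 2)]⟩)
  obtain ⟨Ψ, hp, hc, hs⟩ := exists_formula_of_values hψa hψb hlen
    (.or (χ (-1)) (.or (χ 0) (χ 1))) (by simp [χ, carryFormula, freePos])
  refine ⟨σ, 3, Ψ, fun k _ _ => hσ k, hp, ?_, fun w q => ?_⟩
  · intro z hz
    have := hc hz
    simp [χ, carryFormula, freeCount, CTerm.vars, CTerm.var] at this ⊢
    omega
  · have hχ : ∀ c, Sat w (fun _ => 1) (Function.update (Function.update (Function.update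
        (Function.update (fun _ => 0) 3 q) 0 (e a w : ℚ)) 1 (e b w : ℚ)) 2 (w.length : ℚ)) (χ c) ↔
        carry w = c ∧ q = ((e a w + ε * e b w - c * ((w.length + 1 : ℕ) : ℤ) : ℤ) : ℚ) := by
      intro c
      refine and_congr (sat_carryFormula w _ _ ε c (e a w) (e b w)
        (by simp) (by simp) (by simp)) ?_
      simp only [Sat, CTerm.eval, CTerm.var, Function.update_apply, List.map_cons, List.map_nil,
        List.sum_cons, List.sum_nil]
      norm_num
      constructor <;> intro h <;> linarith
    have h2 := (arith w).2.1
    have h3 := Finset.mem_Icc.1 (arith w).2.2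
    rw [hs]
    refine (or_congr (hχ _) (or_congr (hχ _) (hχ _))).trans ?_
    change _ ↔ q = ((e (fun w => a w + ε * b w) w : ℤ) : ℚ)
    rw [h2]
    obtain h | h | h : carry w = -1 ∨ carry w = 0 ∨ carry w = 1 := by omega
    all_goals rw [h]; simp

end FOC

/-- **Proposition (extra-precision addition and subtraction).** If
`a, b : Σ* → E_{r,s,n'}` (where `n' = |w| + 1`) are each defined in FOC[+;MOD]
by a family of sentences for the bits of the fixed part together with a
formula for the extra digit, and `a + b` takes values in `E_{r,s,n'}`, then
`a + b` is so definable; similarly `a − b` is definable when it takes values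
in `E_{r,s,n'}`. -/
theorem extra_precision_add_sub {A : Type} [Fintype A] (r s : ℕ)
    (a b : List A → ℚ)
    (ha : ∀ w, a w ∈ FOC.EsetQ r s (w.length + 1))
    (hb : ∀ w, b w ∈ FOC.EsetQ r s (w.length + 1))
    (σa : ℤ → FOC.Formula A) (xa : ℕ) (φa : FOC.Formula A)
    (hda : FOC.EDefinedBy r s a σa xa φa)
    (σb : ℤ → FOC.Formula A) (xb : ℕ) (φb : FOC.Formula A)
    (hdb : FOC.EDefinedBy r s b σb xb φb) :
    ((∀ w, a w + b w ∈ FOC.EsetQ r s (w.length + 1)) →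
      ∃ (σ : ℤ → FOC.Formula A) (xv : ℕ) (φx : FOC.Formula A),
        FOC.EDefinedBy r s (fun w => a w + b w) σ xv φx) ∧
    ((∀ w, a w - b w ∈ FOC.EsetQ r s (w.length + 1)) →
      ∃ (σ : ℤ → FOC.Formula A) (xv : ℕ) (φx : FOC.Formula A),
        FOC.EDefinedBy r s (fun w => a w - b w) σ xv φx) := by
  have key := FOC.exists_eDefinedBy_add_mul r s a b ha hb σa xa φa hda σb xb φb hdb
  exact ⟨fun _ => by simpa using key 1 (.inl rfl),
    fun _ => by simpa [sub_eq_add_neg] using key (-1) (.inr rfl)⟩
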